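/- arXiv:math/0406542 — 2 statements merged into one kernel-verified Lean document; each statement's English description precedes it below -/
import Mathlib

section
/- Let G be a finite simple graph with at least one vertex, and let k ≥ 1. If the automorphism group of G satisfies |Aut(G)| ≤ k!, then D(G) ≤ k. -/
/-- A labelling `φ : V → Fin k` of the vertices of a simple graph `G` is
distinguishing if the only graph automorphism preserving it is the identity. -/
def IsGraphDistinguishing {V : Type*} (G : SimpleGraph V) {k : ℕ} (φ : V → Fin k) : Prop :=
  ∀ σ : G ≃g G, (∀ v : V, φ (σ v) = φ v) → ∀ v : V, σ v = v

/-- The distinguishing number `D(G)` of a simple graph `G`: the least number of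
labels admitting a distinguishing labelling. -/
noncomputable def graphDistinguishingNumber {V : Type*} (G : SimpleGraph V) : ℕ :=
  sInf {k : ℕ | ∃ φ : V → Fin k, IsGraphDistinguishing G φ}

/-- If a finite group of order at most `(n + 1)!` acts on a type, some labelling with `n + 1` labels
is preserved only by the elements acting trivially. -/
theorem MulAction.exists_distinguishing_of_card_le_factorial {X : Type*} (n : ℕ) :
    ∀ (Γ : Type*) [Group Γ] [Finite Γ] [MulAction Γ X],
      Nat.card Γ ≤ (n + 1).factorial →
      ∃ φ : X → Fin (n + 1), ∀ g : Γ, (∀ x, φ (g • x) = φ x) → ∀ x : X, g • x = x := by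
  classical
  induction n with
  | zero =>
    intro Γ _ _ _ h
    have : Subsingleton Γ := Finite.card_le_one_iff_subsingleton.mp (by simpa using h)
    exact ⟨fun _ => 0, fun g _ x => by rw [Subsingleton.elim g 1, one_smul]⟩
  | succ n ih =>
    intro Γ _ _ _ h
    have hfin (x : X) : Finite (MulAction.orbit Γ x) := Set.finite_range (fun g : Γ => g • x)
    by_cases hx : ∃ x : X, n + 2 < Nat.card (MulAction.orbit Γ x)
    · obtain ⟨v, hv⟩ := hx
      have hmul : Nat.card (MulAction.orbit Γ v) * Nat.card (MulAction.stabilizer Γ v) =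
          Nat.card Γ := by
        rw [← Nat.card_prod]
        exact Nat.card_congr (MulAction.orbitProdStabilizerEquivGroup Γ v)
      have hcard : Nat.card (MulAction.stabilizer Γ v) ≤ (n + 1).factorial := by
        rw [Nat.factorial_succ] at h
        exact Nat.le_of_mul_le_mul_left
          ((Nat.mul_le_mul_right _ hv.le).trans (hmul.le.trans h)) (by omega)
      obtain ⟨φ, hφ⟩ := ih (MulAction.stabilizer Γ v) hcard
      refine ⟨fun x => if x = v then Fin.last _ else (φ x).castSucc, fun g hg => ?_⟩
      have hgv : g • v = v := by
        by_contra hne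
        have := hg v
        simp only [hne, if_true, if_false] at this
        exact Fin.castSucc_ne_last _ this
      refine hφ ⟨g, hgv⟩ fun x => ?_
      change φ (g • x) = φ x
      by_cases hxv : x = v
      · rw [hxv, hgv]
      · have hgx : g • x ≠ v := fun h => hxv (MulAction.injective g (h.trans hgv.symm))
        simpa [hxv, hgx] using hg x
    · push Not at hx
      have hemb (ω : MulAction.orbitRel.Quotient Γ X) :
          ∃ f : X → Fin (n + 2), Set.InjOn f (MulAction.orbit Γ ω.out) := by
        obtain ⟨f⟩ : Nonempty (MulAction.orbit Γ ω.out ↪ Fin (n + 2)) := by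
          have := Fintype.ofFinite (MulAction.orbit Γ ω.out)
          apply Function.Embedding.nonempty_of_card_le
          rw [← Nat.card_eq_fintype_card, Fintype.card_fin]
          exact hx ω.out
        refine ⟨fun x => if hx : x ∈ MulAction.orbit Γ ω.out then f ⟨x, hx⟩ else 0, ?_⟩
        intro x hx y hy hxy
        simpa [hx, hy] using hxy
      choose f hf using hemb
      refine ⟨fun x => f (Quotient.mk (MulAction.orbitRel Γ X) x) x, fun g hg x => ?_⟩
      have hmk : Quotient.mk (MulAction.orbitRel Γ X) (g • x) =
          Quotient.mk (MulAction.orbitRel Γ X) x :=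
        Quotient.sound (s := MulAction.orbitRel Γ X) (MulAction.mem_orbit x g)
      have hmem (y : X) : y ∈ MulAction.orbit Γ (Quotient.mk (MulAction.orbitRel Γ X) y).out :=
        (MulAction.orbitRel Γ X).symm (Quotient.mk_out (s := MulAction.orbitRel Γ X) y)
      have hgx := hg x
      simp only [hmk] at hgx
      exact hf _ (hmk ▸ hmem (g • x)) (hmem x) hgx

/-- (Albertson–Collins–Kleitman) A graph `G` with `|Aut(G)| ≤ k!` has
distinguishing number `D(G) ≤ k`. -/
theorem graphDistinguishingNumber_le_of_card_aut_le_factorial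
    (V : Type*) [Fintype V] [Nonempty V] (G : SimpleGraph V)
    (k : ℕ) (hk : 1 ≤ k) (h : Nat.card (G ≃g G) ≤ Nat.factorial k) :
    graphDistinguishingNumber G ≤ k := by
  obtain ⟨n, rfl⟩ := Nat.exists_eq_add_of_le' hk
  have : Finite (G ≃g G) := Finite.of_injective _ DFunLike.coe_injective
  exact Nat.sInf_le (MulAction.exists_distinguishing_of_card_le_factorial (X := V) n (G ≃g G) h)
end

section
/- Let the symmetric group S₄ act on a finite nonempty set X. Then D_{S₄}(X) ∈ {1, 2, 3, 4}. If moreover the action is faithful (only the identity of S₄ fixes every element of X), then D_{S₄}(X) ∈ {2, 3, 4}. -/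
/-- A labelling `φ : X → Fin k` is distinguishing for the action of `Γ` on `X`
if every group element preserving the labelling fixes every element of `X`. -/
def IsDistinguishing (Γ : Type*) {X : Type*} [Group Γ] [MulAction Γ X] {k : ℕ}
    (φ : X → Fin k) : Prop :=
  ∀ g : Γ, (∀ x : X, φ (g • x) = φ x) → ∀ x : X, g • x = x

/-- The distinguishing number of the action of `Γ` on `X`: the least `k`
admitting a distinguishing labelling with `k` labels. -/
noncomputable def distinguishingNumber (Γ X : Type*) [Group Γ] [MulAction Γ X] : ℕ :=
  sInf {k : ℕ | ∃ φ : X → Fin k, IsDistinguishing Γ φ}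

/-- A labelling that separates the points of every orbit is distinguishing; such a labelling
exists when all orbits are small. -/
theorem exists_isDistinguishing_of_card_orbit_le {Γ X : Type*} [Group Γ] [Finite Γ]
    [MulAction Γ X] {k : ℕ} (h : ∀ x : X, Nat.card (MulAction.orbit Γ x) ≤ k + 1) :
    ∃ φ : X → Fin (k + 1), IsDistinguishing Γ φ := by
  have separate : ∀ q : MulAction.orbitRel.Quotient Γ X,
      ∃ f : X → Fin (k + 1), Set.InjOn f q.orbit := by
    intro q
    induction q using Quotient.inductionOn' with | h x
    rw [MulAction.orbitRel.Quotient.orbit_mk]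
    have hfin : (MulAction.orbit Γ x).Finite := Set.finite_range _
    have hcard : (MulAction.orbit Γ x).encard ≤ (Set.univ : Set (Fin (k + 1))).encard := by
      rw [← hfin.cast_ncard_eq, Set.encard_univ, ENat.card_eq_coe_natCard, Nat.card_fin]
      exact_mod_cast h x
    obtain ⟨f, -, hf⟩ := hfin.exists_injOn_of_encard_le hcard
    exact ⟨f, hf⟩
  choose f hf using separate
  refine ⟨fun x ↦ f (Quotient.mk'' x) x, fun g hg x ↦ ?_⟩
  have hq : (Quotient.mk'' (g • x) : MulAction.orbitRel.Quotient Γ X) = Quotient.mk'' x :=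
    Quotient.sound' (MulAction.mem_orbit x g)
  have hgx := hg x
  beta_reduce at hgx
  rw [hq] at hgx
  apply hf (Quotient.mk'' x) _ _ hgx <;> rw [MulAction.orbitRel.Quotient.orbit_mk]
  · exact MulAction.mem_orbit x g
  · exact MulAction.mem_orbit_self x

/-- A distinguishing labelling for the stabilizer of a point extends to one for the whole group,
at the cost of one more label, reserved for that point. -/
theorem exists_isDistinguishing_succ_of_stabilizer {Γ X : Type*} [Group Γ] [MulAction Γ X]
    {k : ℕ} (x : X) {ψ : X → Fin k} (hψ : IsDistinguishing (MulAction.stabilizer Γ x) ψ) :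
    ∃ φ : X → Fin (k + 1), IsDistinguishing Γ φ := by
  classical
  refine ⟨fun y ↦ if y = x then Fin.last k else (ψ y).castSucc, fun g hg ↦ ?_⟩
  have hgx : g • x = x := by
    by_contra hne
    simpa [hne, Fin.castSucc_ne_last] using hg x
  refine hψ ⟨g, MulAction.mem_stabilizer_iff.mpr hgx⟩ fun y ↦ ?_
  rw [Subgroup.mk_smul]
  by_cases hy : y = x
  · rw [hy, hgx]
  · have hgy : g • y ≠ x := fun h ↦ hy (MulAction.injective g (h.trans hgx.symm))
    simpa [hy, hgy] using hg y

/-- A group of order at most `(k + 1)!` has a distinguishing labelling with `k + 1` labels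
on every set it acts on. -/
theorem exists_isDistinguishing_of_card_le_factorial {Γ X : Type*} [Group Γ] [Finite Γ]
    [MulAction Γ X] {k : ℕ} (hk : Nat.card Γ ≤ (k + 1).factorial) :
    ∃ φ : X → Fin (k + 1), IsDistinguishing Γ φ := by
  induction k generalizing Γ with
  | zero =>
    have : Subsingleton Γ := Finite.card_le_one_iff_subsingleton.mp hk
    exact ⟨fun _ ↦ 0, fun g _ x ↦ by rw [Subsingleton.elim g 1, one_smul]⟩
  | succ k ih =>
    by_cases h : ∀ x : X, Nat.card (MulAction.orbit Γ x) ≤ k + 2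
    · exact exists_isDistinguishing_of_card_orbit_le h
    · push Not at h
      obtain ⟨x, hx⟩ := h
      have hmul : Nat.card (MulAction.orbit Γ x) * Nat.card (MulAction.stabilizer Γ x)
          = Nat.card Γ := by
        rw [← Nat.card_prod]
        exact Nat.card_congr (MulAction.orbitProdStabilizerEquivGroup Γ x)
      have hstab : Nat.card (MulAction.stabilizer Γ x) ≤ (k + 1).factorial := by
        refine Nat.le_of_mul_le_mul_left ?_ (Nat.succ_pos (k + 1))
        calc (k + 2) * Nat.card (MulAction.stabilizer Γ x)
            ≤ Nat.card (MulAction.orbit Γ x) * Nat.card (MulAction.stabilizer Γ x) :=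
              Nat.mul_le_mul_right _ hx.le
          _ = Nat.card Γ := hmul
          _ ≤ (k + 2).factorial := hk
          _ = (k + 2) * (k + 1).factorial := Nat.factorial_succ (k + 1)
      obtain ⟨ψ, hψ⟩ := ih hstab
      exact exists_isDistinguishing_succ_of_stabilizer x hψ


/-- For any action of `S₄` on a finite nonempty set `X`, the distinguishing number
is `1`, `2`, `3`, or `4`; if the action is faithful, it is `2`, `3`, or `4`. -/
theorem distinguishingNumber_S4_action
    (X : Type*) [Fintype X] [Nonempty X] [MulAction (Equiv.Perm (Fin 4)) X] :
    distinguishingNumber (Equiv.Perm (Fin 4)) X ∈ ({1, 2, 3, 4} : Set ℕ) ∧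
      ((∀ g : Equiv.Perm (Fin 4), (∀ x : X, g • x = x) → g = 1) →
        distinguishingNumber (Equiv.Perm (Fin 4)) X ∈ ({2, 3, 4} : Set ℕ)) := by
  set d := distinguishingNumber (Equiv.Perm (Fin 4)) X with hd
  have hex : ∃ φ : X → Fin 4, IsDistinguishing (Equiv.Perm (Fin 4)) φ := by
    apply exists_isDistinguishing_of_card_le_factorial
    rw [Nat.card_perm, Nat.card_fin]
  have hle : d ≤ 4 := Nat.sInf_le hex
  obtain ⟨φ, hφ⟩ : ∃ φ : X → Fin d, IsDistinguishing (Equiv.Perm (Fin 4)) φ :=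
    Nat.sInf_mem (s := {k : ℕ | ∃ φ : X → Fin k, IsDistinguishing (Equiv.Perm (Fin 4)) φ})
      ⟨4, hex⟩
  have hpos : 0 < d := Fin.pos (φ (Classical.arbitrary X))
  clear_value d
  simp only [Set.mem_insert_iff, Set.mem_singleton_iff]
  refine ⟨by lia, fun hfaithful ↦ ?_⟩
  have hne : d ≠ 1 := by
    rintro rfl
    exact absurd (hfaithful (Equiv.swap 0 1) (hφ _ fun x ↦ Subsingleton.elim _ _)) (by decide)
  lia
end
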